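/- Let B_1, B_2, B_3, B_4 be (n+1)×(n+1) quaternion Hermitian matrices and let X be an (n+1)×(n+1) quaternion Hermitian positive semidefinite matrix with (1,1)-entry X_{11} = 1 and B_j • X ≤ 0 for j = 1,…,4. Then there exists y ∈ ℍⁿ such that, for every j = 1,…,4, the real number B_j • [[1, yᴴ],[y, yyᴴ]] is ≤ 0; moreover it is zero whenever B_j • X = 0 and strictly negative whenever B_j • X < 0. -/

import Mathlib

open Matrix Quaternion BigOperators

/-- The quadratic form `xᴴ A x` of a quaternion matrix. -/
noncomputable def qform {m : Type*} [Fintype m] (A : Matrix m m ℍ[ℝ]) (x : m → ℍ[ℝ]) : ℍ[ℝ] :=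
  star x ⬝ᵥ A.mulVec x

/-- The inner product `A • B = Re (tr (Aᴴ B))` of quaternion matrices. -/
noncomputable def qdot {m : Type*} [Fintype m] (A B : Matrix m m ℍ[ℝ]) : ℝ :=
  (Matrix.trace (Aᴴ * B)).re

/-- A quaternion matrix is Hermitian positive semidefinite:
it is Hermitian and `xᴴ X x ≥ 0` for all `x`. -/
def qPSD {m : Type*} [Fintype m] (X : Matrix m m ℍ[ℝ]) : Prop :=
  X.IsHermitian ∧ ∀ x : m → ℍ[ℝ], 0 ≤ (star x ⬝ᵥ X.mulVec x).re

/-- The `(n+1) × (n+1)` quaternion block matrix `[[a, bᴴ], [b, A]]` with real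
`(1,1)`-entry `a`, first row continuing with `bᴴ`, first column continuing
with `b`, and lower-right block `A`. -/
noncomputable def qblock {n : ℕ} (a : ℝ) (b : Fin n → ℍ[ℝ])
    (A : Matrix (Fin n) (Fin n) ℍ[ℝ]) :
    Matrix (Unit ⊕ Fin n) (Unit ⊕ Fin n) ℍ[ℝ] :=
  Matrix.fromBlocks (Matrix.of fun _ _ => (a : ℍ[ℝ]))
    (Matrix.of fun _ j => star (b j)) (Matrix.of fun i _ => b i) A

theorem quaternion_re_mul_comm (a b : ℍ[ℝ]) : (a * b).re = (b * a).re := by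
  simp only [Quaternion.re_mul]; ring

theorem quaternion_re_sum {ι : Type*} (s : Finset ι) (f : ι → ℍ[ℝ]) :
    (∑ i ∈ s, f i).re = ∑ i ∈ s, (f i).re :=
  map_sum (QuaternionAlgebra.reₗ (R := ℝ) (-1) 0 (-1)) f s

theorem isHermitian_vecMulVec_star {m : Type*} (x : m → ℍ[ℝ]) :
    (vecMulVec x (star x)).IsHermitian := by
  ext1 i j
  simp [vecMulVec_apply]

section Forms

variable {m : Type*} [Fintype m]

theorem qform_add_re {A : Matrix m m ℍ[ℝ]} (hA : A.IsHermitian) (x y : m → ℍ[ℝ]) :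
    (qform A (x + y)).re = (qform A x).re + (qform A y).re + 2 * (star x ⬝ᵥ A *ᵥ y).re := by
  have h : (star y ⬝ᵥ A *ᵥ x).re = (star x ⬝ᵥ A *ᵥ y).re := by
    rw [← Quaternion.re_star, ← Matrix.star_dotProduct_star, star_star, Matrix.star_mulVec,
      hA.eq, ← Matrix.dotProduct_mulVec]
  simp only [qform, star_add, mulVec_add, add_dotProduct, dotProduct_add, Quaternion.re_add, h]
  ring

theorem qform_op_smul_re (A : Matrix m m ℍ[ℝ]) (x : m → ℍ[ℝ]) (u : ℍ[ℝ]) :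
    (qform A (MulOpposite.op u • x)).re = Quaternion.normSq u * (qform A x).re := by
  have h : qform A (MulOpposite.op u • x) = star u * (qform A x * u) := by
    simp only [qform, mulVec_smul, dotProduct_smul, MulOpposite.smul_eq_mul_unop,
      MulOpposite.unop_op]
    rw [← mul_assoc]
    simp [dotProduct, Finset.mul_sum, mul_assoc]
  rw [h, quaternion_re_mul_comm, mul_assoc, Quaternion.self_mul_star, quaternion_re_mul_comm,
    Quaternion.coe_mul_eq_smul]
  simp

theorem qform_smul_re (A : Matrix m m ℍ[ℝ]) (x : m → ℍ[ℝ]) (c : ℝ) :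
    (qform A (c • x)).re = c ^ 2 * (qform A x).re := by
  have hs : star (c • x) = c • star x := funext fun i => Quaternion.star_smul c (x i)
  simp only [qform, mulVec_smul, dotProduct_smul, hs, smul_dotProduct,
    Quaternion.re_smul, smul_eq_mul]
  ring

theorem qform_smul_add_smul_re {A : Matrix m m ℍ[ℝ]} (hA : A.IsHermitian) (x y : m → ℍ[ℝ])
    (c s : ℝ) :
    (qform A (c • x + s • y)).re =
      c ^ 2 * (qform A x).re + s ^ 2 * (qform A y).re + 2 * (c * s) * (star x ⬝ᵥ A *ᵥ y).re := by
  have hs : star (c • x) = c • star x := funext fun i => Quaternion.star_smul c (x i)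
  rw [qform_add_re hA, qform_smul_re, qform_smul_re, hs, mulVec_smul, dotProduct_smul,
    smul_dotProduct]
  simp only [Quaternion.re_smul, smul_eq_mul]
  ring

theorem qdot_vecMulVec {A : Matrix m m ℍ[ℝ]} (hA : A.IsHermitian) (x : m → ℍ[ℝ]) :
    qdot A (vecMulVec x (star x)) = (qform A x).re := by
  simp only [qdot, hA.eq, qform, trace, diag, mul_apply, dotProduct, mulVec, vecMulVec_apply,
    quaternion_re_sum, Finset.mul_sum, Pi.star_apply]
  refine Finset.sum_congr rfl fun i _ => Finset.sum_congr rfl fun k _ => ?_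
  rw [← mul_assoc, quaternion_re_mul_comm]

/-- Fewer than four real-linear conditions `Re (p j * u) = 0` have a common unit solution. -/
theorem exists_normSq_one_re_mul_eq_zero {ι : Type*} (S : Finset ι) (hS : S.card < 4)
    (p : ι → ℍ[ℝ]) : ∃ u : ℍ[ℝ], Quaternion.normSq u = 1 ∧ ∀ j ∈ S, (p j * u).re = 0 := by
  let f : ℍ[ℝ] →ₗ[ℝ] (S → ℝ) :=
    LinearMap.pi fun j => (QuaternionAlgebra.reₗ (R := ℝ) (-1) 0 (-1)) ∘ₗ
      LinearMap.mulLeft ℝ (p j)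
  have hker : LinearMap.ker f ≠ ⊥ := by
    apply LinearMap.ker_ne_bot_of_finrank_lt
    simpa [Quaternion.finrank_eq_four] using hS
  obtain ⟨v, hv, hv0⟩ := Submodule.exists_mem_ne_zero_of_ne_bot hker
  have hf : f (‖v‖⁻¹ • v) = 0 := by rw [map_smul, LinearMap.mem_ker.1 hv, smul_zero]
  refine ⟨‖v‖⁻¹ • v, ?_, fun j hj => congrFun hf ⟨j, hj⟩⟩
  rw [Quaternion.normSq_eq_norm_mul_self, norm_smul, norm_inv, norm_norm,
    inv_mul_cancel₀ (norm_ne_zero_iff.2 hv0), one_mul]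

theorem exists_sq_add_sq_eq_one_and_eq {p r a : ℝ} (b : ℝ) (ha : a ∈ Set.uIcc p r) :
    ∃ c s : ℝ, c ^ 2 + s ^ 2 = 1 ∧ c ^ 2 * p + s ^ 2 * r + 2 * (c * s) * b = a := by
  let f : ℝ → ℝ := fun t =>
    Real.cos t ^ 2 * p + Real.sin t ^ 2 * r + 2 * (Real.cos t * Real.sin t) * b
  have hf : Continuous f := by fun_prop
  have h := intermediate_value_uIcc (a := 0) (b := Real.pi / 2) hf.continuousOn
  have h0 : f 0 = p := by simp [f]
  have h1 : f (Real.pi / 2) = r := by simp [f]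
  rw [h0, h1] at h
  obtain ⟨t, -, ht⟩ := h ha
  exact ⟨Real.cos t, Real.sin t, Real.cos_sq_add_sin_sq t, ht⟩

/-- A pair of vectors may be replaced by another one with the same sum of rank-one matrices,
keeping the common values of three forms and prescribing an intermediate value of a fourth. -/
theorem exists_rotation {ι : Type*} {B : ι → Matrix m m ℍ[ℝ]} (hB : ∀ j, (B j).IsHermitian)
    {S : Finset ι} (hS : S.card < 4) (k : ι) (a : ι → ℝ) {x y : m → ℍ[ℝ]}
    (hx : ∀ j ∈ S, (qform (B j) x).re = a j) (hy : ∀ j ∈ S, (qform (B j) y).re = a j)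
    (hk : a k ∈ Set.uIcc (qform (B k) x).re (qform (B k) y).re) :
    ∃ x' y' : m → ℍ[ℝ],
      (∀ A : Matrix m m ℍ[ℝ], A.IsHermitian →
        (qform A x').re + (qform A y').re = (qform A x).re + (qform A y).re) ∧
      (∀ j ∈ S, (qform (B j) x').re = a j) ∧ (qform (B k) x').re = a k := by
  obtain ⟨u, hu, hu'⟩ :=
    exists_normSq_one_re_mul_eq_zero S hS fun j => star x ⬝ᵥ B j *ᵥ y
  set z : m → ℍ[ℝ] := MulOpposite.op u • y with hz
  have hqz (A : Matrix m m ℍ[ℝ]) : (qform A z).re = (qform A y).re := by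
    rw [hz, qform_op_smul_re, hu, one_mul]
  have hxz (A : Matrix m m ℍ[ℝ]) : star x ⬝ᵥ A *ᵥ z = (star x ⬝ᵥ A *ᵥ y) * u := by
    rw [hz, mulVec_smul, dotProduct_smul, MulOpposite.smul_eq_mul_unop, MulOpposite.unop_op]
  obtain ⟨c, s, hcs, hval⟩ :=
    exists_sq_add_sq_eq_one_and_eq (star x ⬝ᵥ B k *ᵥ z).re hk
  refine ⟨c • x + s • z, (-s) • x + c • z, fun A hA => ?_, fun j hj => ?_, ?_⟩
  · rw [qform_smul_add_smul_re hA, qform_smul_add_smul_re hA, hqz]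
    linear_combination ((qform A x).re + (qform A y).re) * hcs
  · rw [qform_smul_add_smul_re (hB j), hqz, hxz, hu' j hj, hx j hj, hy j hj]
    linear_combination a j * hcs
  · rw [qform_smul_add_smul_re (hB k), hqz, hval]

theorem Fintype.sum_update_update {ι M V : Type*} [Fintype ι] [DecidableEq ι]
    [AddCommMonoid M] (f : V → M) (x : ι → V) {i j : ι} (hij : i ≠ j) {a b : V}
    (h : f a + f b = f (x i) + f (x j)) :
    ∑ l, f (Function.update (Function.update x i a) j b l) = ∑ l, f (x l) := by
  have hi : i ∈ Finset.univ.erase j := Finset.mem_erase.2 ⟨hij, Finset.mem_univ i⟩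
  rw [← Finset.add_sum_erase _ _ (Finset.mem_univ j), ← Finset.add_sum_erase _ _ hi,
    ← Finset.add_sum_erase _ (fun l => f (x l)) (Finset.mem_univ j),
    ← Finset.add_sum_erase _ (fun l => f (x l)) hi, ← add_assoc, ← add_assoc]
  congr 1
  · simpa [hij, add_comm] using h
  · refine Finset.sum_congr rfl fun l hl => ?_
    simp only [Finset.mem_erase] at hl
    simp [hl.1, hl.2.1]

/-- Rank-one decompositions can be chosen so that four Hermitian forms are constant on them. -/
theorem exists_family_qform_eq_div {ι : Type*} {r : ℕ} {B : ι → Matrix m m ℍ[ℝ]}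
    (hB : ∀ j, (B j).IsHermitian) {X : Matrix m m ℍ[ℝ]}
    (hX : ∃ x : Fin r → m → ℍ[ℝ], ∀ A : Matrix m m ℍ[ℝ], A.IsHermitian →
      ∑ i, (qform A (x i)).re = qdot A X)
    (S : Finset ι) (hS : S.card ≤ 4) :
    ∃ x : Fin r → m → ℍ[ℝ], (∀ A : Matrix m m ℍ[ℝ], A.IsHermitian →
      ∑ i, (qform A (x i)).re = qdot A X) ∧
      ∀ j ∈ S, ∀ i, (qform (B j) (x i)).re = qdot (B j) X / r := by
  classical
  induction S using Finset.induction_on with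
  | empty => simpa using hX
  | insert k S hkS ih =>
    rw [Finset.card_insert_of_notMem hkS] at hS
    set a : ι → ℝ := fun j => qdot (B j) X / r with ha
    let bad (x : Fin r → m → ℍ[ℝ]) : Finset (Fin r) := {i | (qform (B k) (x i)).re ≠ a k}
    suffices key : ∀ N, ∀ x : Fin r → m → ℍ[ℝ], (bad x).card = N →
        (∀ A : Matrix m m ℍ[ℝ], A.IsHermitian → ∑ i, (qform A (x i)).re = qdot A X) →
        (∀ j ∈ S, ∀ i, (qform (B j) (x i)).re = a j) →
        ∃ x : Fin r → m → ℍ[ℝ], (∀ A : Matrix m m ℍ[ℝ], A.IsHermitian →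
          ∑ i, (qform A (x i)).re = qdot A X) ∧
          ∀ j ∈ insert k S, ∀ i, (qform (B j) (x i)).re = a j by
      obtain ⟨x, hx, hxS⟩ := ih (by omega)
      exact key _ x rfl hx hxS
    intro N
    induction N using Nat.strong_induction_on with
    | _ N ihN =>
    intro x hN hx hxS
    by_cases hall : ∀ i, (qform (B k) (x i)).re = a k
    · exact ⟨x, hx, fun j hj => (Finset.mem_insert.1 hj).elim (fun h => h ▸ hall) (hxS j)⟩
    push Not at hall
    obtain ⟨i₀, hi₀⟩ := hall
    have hr : (r : ℝ) ≠ 0 := by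
      have := i₀.pos
      positivity
    have hsum : ∑ i, ((qform (B k) (x i)).re - a k) = 0 := by
      rw [Finset.sum_sub_distrib, hx _ (hB k)]
      simp only [ha, Finset.sum_const, Finset.card_univ, Fintype.card_fin, nsmul_eq_mul]
      field_simp
      ring
    have hex : ∃ i ∈ Finset.univ, (qform (B k) (x i)).re - a k ≠ 0 :=
      ⟨i₀, Finset.mem_univ _, sub_ne_zero.2 hi₀⟩
    obtain ⟨i, -, hi⟩ := Finset.exists_pos_of_sum_zero_of_exists_nonzero _ hsum hex
    obtain ⟨j, -, hj⟩ := Finset.exists_pos_of_sum_zero_of_exists_nonzero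
      (fun i => -((qform (B k) (x i)).re - a k)) (by rw [Finset.sum_neg_distrib, hsum, neg_zero])
      ⟨i₀, Finset.mem_univ _, neg_ne_zero.2 (sub_ne_zero.2 hi₀)⟩
    have hij : i ≠ j := by
      rintro rfl
      linarith
    obtain ⟨y, z, hyz, hyS, hyk⟩ := exists_rotation hB (by omega : S.card < 4) k a
      (fun l hl => hxS l hl i) (fun l hl => hxS l hl j)
      (Set.mem_uIcc.2 (Or.inr ⟨by linarith, by linarith⟩))
    refine ihN (bad (Function.update (Function.update x i y) j z)).card ?_ _ rfl
      (fun A hA => ?_) fun l hl t => ?_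
    · rw [← hN]
      refine Finset.card_lt_card (Finset.ssubset_iff_of_subset ?_ |>.2 ⟨i, ?_, ?_⟩)
      · intro t ht
        simp only [bad, Finset.mem_filter, Finset.mem_univ, true_and] at ht ⊢
        by_cases htj : t = j
        · subst htj
          intro h
          linarith
        by_cases hti : t = i
        · subst hti
          intro h
          linarith
        simpa [htj, hti] using ht
      · simp only [bad, Finset.mem_filter, Finset.mem_univ, true_and]
        intro h
        linarith
      · simp [bad, hij, hyk]
    · rw [Fintype.sum_update_update (fun v => (qform A v).re) x hij (hyz A hA), hx A hA]
    · by_cases htj : t = j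
      · subst htj
        have := hyz _ (hB l)
        rw [hyS l hl, hxS l hl, hxS l hl] at this
        simpa using this
      by_cases hti : t = i
      · subst hti
        simpa [htj] using hyS l hl
      simpa [htj, hti] using hxS l hl t

theorem qPSD.apply_self {X : Matrix m m ℍ[ℝ]} (hX : qPSD X) (k : m) :
    X k k = ((X k k).re : ℍ[ℝ]) :=
  Quaternion.star_eq_self.1 (hX.1.apply k k)

/-- The form of a positive semidefinite matrix along the line through `v` in direction `eₖ`. -/
theorem qPSD.line_nonneg [DecidableEq m] {X : Matrix m m ℍ[ℝ]} (hX : qPSD X) (k : m)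
    (v : m → ℍ[ℝ]) (t : ℝ) :
    0 ≤ (qform X v).re - 2 * t * Quaternion.normSq ((X *ᵥ v) k) +
      t ^ 2 * Quaternion.normSq ((X *ᵥ v) k) * (X k k).re := by
  set w := (X *ᵥ v) k with hw
  have h := hX.2 (Pi.single k (-(t • w)) + v)
  rw [← qform, qform_add_re hX.1] at h
  have h1 : (qform X (Pi.single k (-(t • w)))).re =
      t ^ 2 * Quaternion.normSq w * (X k k).re := by
    have : (Pi.single k (-(t • w)) : m → ℍ[ℝ]) =
        MulOpposite.op (-(t • w)) • (Pi.single k 1 : m → ℍ[ℝ]) := by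
      rw [← Pi.single_smul]
      simp
    rw [this, qform_op_smul_re, Quaternion.normSq_neg, Quaternion.normSq_smul]
    simp [qform]
  have h2 : (star (Pi.single k (-(t • w))) ⬝ᵥ X *ᵥ v).re = -(t * Quaternion.normSq w) := by
    rw [← Pi.single_star, single_dotProduct, ← hw, star_neg, Quaternion.star_smul, neg_mul,
      smul_mul_assoc, Quaternion.star_mul_self]
    simp
  rw [h1, h2] at h
  linarith

theorem qPSD.apply_self_re_nonneg [DecidableEq m] {X : Matrix m m ℍ[ℝ]} (hX : qPSD X) (k : m) :
    0 ≤ (X k k).re := by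
  simpa [← Pi.single_star] using hX.2 (Pi.single k 1)

theorem qPSD.apply_eq_zero [DecidableEq m] {X : Matrix m m ℍ[ℝ]} (hX : qPSD X) {k : m}
    (hk : (X k k).re = 0) (j : m) : X k j = 0 := by
  by_contra hne
  have hpos : 0 < Quaternion.normSq (X k j) :=
    lt_of_le_of_ne Quaternion.normSq_nonneg (Ne.symm (Quaternion.normSq_ne_zero.2 hne))
  have h := hX.line_nonneg k (Pi.single j 1)
    (((X j j).re + 1) / (2 * Quaternion.normSq (X k j)))
  have h1 : (qform X (Pi.single j 1)).re = (X j j).re := by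
    simp [qform]
  have h2 : (X *ᵥ Pi.single j 1) k = X k j := by simp
  rw [h1, h2, hk] at h
  field_simp at h
  linarith

/-- The Schur complement of a positive diagonal entry is positive semidefinite. -/
theorem qPSD.sub_vecMulVec [DecidableEq m] {X : Matrix m m ℍ[ℝ]} (hX : qPSD X) {k : m}
    (hk : 0 < (X k k).re) {x : m → ℍ[ℝ]} (hx : x = (√(X k k).re)⁻¹ • fun i => X i k) :
    qPSD (X - vecMulVec x (star x)) := by
  refine ⟨hX.1.sub (isHermitian_vecMulVec_star x), fun v => ?_⟩
  have hxv : star x ⬝ᵥ v = (√(X k k).re)⁻¹ • (X *ᵥ v) k := by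
    simp only [hx, dotProduct, mulVec, Pi.star_apply, Pi.smul_apply, Quaternion.star_smul,
      Finset.smul_sum, smul_mul_assoc, hX.1.apply]
  have hvx : star v ⬝ᵥ x = star (star x ⬝ᵥ v) := by
    rw [← Matrix.star_dotProduct_star, star_star]
  have h : (star v ⬝ᵥ vecMulVec x (star x) *ᵥ v).re =
      ((X k k).re)⁻¹ * Quaternion.normSq ((X *ᵥ v) k) := by
    rw [vecMulVec_mulVec, dotProduct_smul, MulOpposite.smul_eq_mul_unop, MulOpposite.unop_op,
      hvx, Quaternion.star_mul_self, hxv, Quaternion.normSq_smul, inv_pow, Real.sq_sqrt hk.le,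
      Quaternion.re_coe]
  rw [sub_mulVec, dotProduct_sub, Quaternion.re_sub, h]
  have hline := hX.line_nonneg k v ((X k k).re)⁻¹
  rw [qform] at hline
  have : ((X k k).re)⁻¹ ^ 2 * Quaternion.normSq ((X *ᵥ v) k) * (X k k).re =
      ((X k k).re)⁻¹ * Quaternion.normSq ((X *ᵥ v) k) := by
    field_simp
  linarith

/-- A positive semidefinite quaternion matrix is a sum of rank-one matrices `x xᴴ`. -/
theorem qPSD.exists_eq_sum_vecMulVec [DecidableEq m] {X : Matrix m m ℍ[ℝ]} (hX : qPSD X) :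
    ∃ (r : ℕ) (x : Fin r → m → ℍ[ℝ]), X = ∑ i, vecMulVec (x i) (star (x i)) := by
  suffices key : ∀ (s : Finset m) (X : Matrix m m ℍ[ℝ]), qPSD X → (∀ i ∉ s, ∀ j, X i j = 0) →
      ∃ (r : ℕ) (x : Fin r → m → ℍ[ℝ]), X = ∑ i, vecMulVec (x i) (star (x i)) from
    key Finset.univ X hX fun i hi => absurd (Finset.mem_univ i) hi
  intro s
  induction s using Finset.induction_on with
  | empty =>
    intro X _ h0
    refine ⟨0, Fin.elim0, ?_⟩
    ext1 i j
    simp [h0 i (Finset.notMem_empty i) j]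
  | insert k s _ ih =>
    intro X hX h0
    rcases (hX.apply_self_re_nonneg k).eq_or_lt' with hk | hk
    · refine ih X hX fun i hi j => ?_
      by_cases hik : i = k
      · subst hik
        exact hX.apply_eq_zero hk j
      · exact h0 i (by simp [hik, hi]) j
    · set x : m → ℍ[ℝ] := (√(X k k).re)⁻¹ • fun i => X i k with hx
      obtain ⟨r, y, hy⟩ := ih _ (hX.sub_vecMulVec hk hx) fun i hi j => by
        by_cases hik : i = k
        · subst hik
          have hd : (√(X i i).re)⁻¹ * ((√(X i i).re)⁻¹ * (X i i).re) = 1 := by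
            rw [← mul_assoc, ← mul_inv, Real.mul_self_sqrt hk.le, inv_mul_cancel₀ hk.ne']
          have : vecMulVec x (star x) i j = X i j := by
            simp only [vecMulVec_apply, hx, Pi.smul_apply, Pi.star_apply, Quaternion.star_smul,
              hX.1.apply, smul_mul_assoc, mul_smul_comm]
            rw [hX.apply_self i, Quaternion.coe_mul_eq_smul, smul_smul, smul_smul,
              Quaternion.re_coe, mul_assoc, hd, one_smul]
          rw [Matrix.sub_apply, this, sub_self]
        · have hi' : ∀ j, X i j = 0 := h0 i (by simp [hik, hi])
          simp [vecMulVec_apply, hx, hi']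
      refine ⟨r + 1, Fin.cons x y, ?_⟩
      rw [Fin.sum_univ_succ]
      simp only [Fin.cons_zero, Fin.cons_succ]
      rw [← hy, add_sub_cancel]

theorem qPSD.exists_family_sum_qform [DecidableEq m] {X : Matrix m m ℍ[ℝ]} (hX : qPSD X) :
    ∃ (r : ℕ) (x : Fin r → m → ℍ[ℝ]), ∀ A : Matrix m m ℍ[ℝ], A.IsHermitian →
      ∑ i, (qform A (x i)).re = qdot A X := by
  obtain ⟨r, x, rfl⟩ := hX.exists_eq_sum_vecMulVec
  refine ⟨r, x, fun A hA => ?_⟩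
  simp only [← qdot_vecMulVec hA, qdot, Finset.mul_sum, trace_sum, quaternion_re_sum]

end Forms

theorem qblock_eq_vecMulVec {n : ℕ} (y : Fin n → ℍ[ℝ]) :
    qblock 1 y (vecMulVec y (star y)) =
      vecMulVec (Sum.elim (fun _ => 1) y : Unit ⊕ Fin n → ℍ[ℝ])
        (star (Sum.elim (fun _ => 1) y)) := by
  ext1 (i | i) (j | j) <;> simp [qblock, vecMulVec_apply]

/-- From a Hermitian PSD matrix X with (1,1)-entry 1 satisfying four
homogenized constraints Bj • X ≤ 0, one can extract y so that the rank-one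
lift [[1, yᴴ], [y, yyᴴ]] satisfies the constraints with matching tightness. -/
theorem rank_one_feasible_extraction {n : ℕ}
    (B : Fin 4 → Matrix (Unit ⊕ Fin n) (Unit ⊕ Fin n) ℍ[ℝ])
    (hB : ∀ j, (B j).IsHermitian)
    (X : Matrix (Unit ⊕ Fin n) (Unit ⊕ Fin n) ℍ[ℝ]) (hX : qPSD X)
    (hX11 : X (Sum.inl ()) (Sum.inl ()) = 1)
    (hfeas : ∀ j, qdot (B j) X ≤ 0) :
    ∃ y : Fin n → ℍ[ℝ], ∀ j,
      qdot (B j) (qblock 1 y (vecMulVec y (star y))) ≤ 0 ∧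
      (qdot (B j) X = 0 → qdot (B j) (qblock 1 y (vecMulVec y (star y))) = 0) ∧
      (qdot (B j) X < 0 → qdot (B j) (qblock 1 y (vecMulVec y (star y))) < 0) := by
  have hE : (Matrix.single (Sum.inl ()) (Sum.inl ()) 1 :
      Matrix (Unit ⊕ Fin n) (Unit ⊕ Fin n) ℍ[ℝ]).IsHermitian := by
    simp [Matrix.IsHermitian]
  obtain ⟨r, hdec⟩ := hX.exists_family_sum_qform
  obtain ⟨x, hx, hxB⟩ := exists_family_qform_eq_div hB hdec Finset.univ (by simp)
  obtain ⟨i, hi⟩ : ∃ i, x i (Sum.inl ()) ≠ 0 := by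
    by_contra! h
    have hzero := hx _ hE
    simp [qform, single_mulVec, h, qdot, trace_single_mul, hX11] at hzero
  set q := x i (Sum.inl ()) with hq
  have hr : 0 < (r : ℝ) := Nat.cast_pos.2 i.pos
  have hpos : 0 < Quaternion.normSq q⁻¹ :=
    lt_of_le_of_ne Quaternion.normSq_nonneg
      (Ne.symm (Quaternion.normSq_ne_zero.2 (inv_ne_zero hi)))
  refine ⟨fun j => x i (Sum.inr j) * q⁻¹, fun j => ?_⟩
  have hlift : qdot (B j) (qblock 1 (fun j => x i (Sum.inr j) * q⁻¹)
      (vecMulVec (fun j => x i (Sum.inr j) * q⁻¹) (star fun j => x i (Sum.inr j) * q⁻¹))) =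
      Quaternion.normSq q⁻¹ / r * qdot (B j) X := by
    rw [qblock_eq_vecMulVec, qdot_vecMulVec (hB j)]
    have : (Sum.elim (fun _ => 1) fun j => x i (Sum.inr j) * q⁻¹ : Unit ⊕ Fin n → ℍ[ℝ]) =
        MulOpposite.op q⁻¹ • x i := by
      ext1 (l | l)
      · simp [← hq, hi]
      · simp
    rw [this, qform_op_smul_re, hxB j (Finset.mem_univ j)]
    ring
  have hc : 0 < Quaternion.normSq q⁻¹ / r := div_pos hpos hr
  rw [hlift]
  exact ⟨mul_nonpos_of_nonneg_of_nonpos hc.le (hfeas j), fun h => by rw [h, mul_zero],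
    fun h => mul_neg_of_pos_of_neg hc h⟩
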